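/- Let G be a finite simple graph that is bull-free and diamond-free, with n ≥ 2 vertices and m ≥ 2 edges. Then either χ(G) ≤ ω(G), or χ(G) ≤ min{ 4√n, 8√(n/log n), 28·m^(1/3)/(log m)^(2/3) }, where log denotes the natural logarithm. -/

import Mathlib

open SimpleGraph

/-- `G` is `H`-free: no induced subgraph of `G` is isomorphic to `H`. -/
def IsIndFree {V W : Type*} (G : SimpleGraph V) (H : SimpleGraph W) : Prop :=
  ∀ s : Set V, ¬ Nonempty (H ≃g G.induce s)

/-- The bull: a triangle with two pendant edges at distinct vertices. -/
def bull : SimpleGraph (Fin 5) :=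
  SimpleGraph.fromEdgeSet {s(0,1), s(1,2), s(0,2), s(1,3), s(2,4)}

/-- The diamond: `K₄` minus an edge. -/
def diamond : SimpleGraph (Fin 4) :=
  SimpleGraph.fromEdgeSet {s(0,2), s(0,3), s(1,2), s(1,3), s(2,3)}

section Coloring

variable {V : Type*} (G : SimpleGraph V)

/-- The subgraph induced by `S` has a proper coloring with colors `0, …, k - 1`. -/
def ColorOn (S : Finset V) (k : ℕ) : Prop :=
  ∃ c : V → ℕ, (∀ v ∈ S, c v < k) ∧ ∀ u ∈ S, ∀ v ∈ S, G.Adj u v → c u ≠ c v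

/-- No two vertices of `I` are adjacent. -/
def IndepOn (I : Finset V) : Prop :=
  ∀ u ∈ I, ∀ v ∈ I, ¬ G.Adj u v

/-- The subgraph induced by `S` contains no triangle. -/
def TriangleFreeOn (S : Finset V) : Prop :=
  ∀ u ∈ S, ∀ v ∈ S, ∀ w ∈ S, G.Adj u v → G.Adj v w → ¬ G.Adj u w

/-- The neighbors of `v` inside `S`. -/
def nbrsIn [DecidableRel G.Adj] (S : Finset V) (v : V) : Finset V :=
  S.filter (G.Adj v)

variable {G}

lemma mem_nbrsIn [DecidableRel G.Adj] {S : Finset V} {u v : V} :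
    u ∈ nbrsIn G S v ↔ u ∈ S ∧ G.Adj v u :=
  Finset.mem_filter

lemma nbrsIn_subset [DecidableRel G.Adj] (S : Finset V) (v : V) : nbrsIn G S v ⊆ S :=
  Finset.filter_subset _ _

lemma TriangleFreeOn.mono {S T : Finset V} (h : TriangleFreeOn G S) (hTS : T ⊆ S) :
    TriangleFreeOn G T :=
  fun u hu v hv w hw => h u (hTS hu) v (hTS hv) w (hTS hw)

lemma TriangleFreeOn.indepOn_nbrsIn [DecidableRel G.Adj] {S : Finset V}
    (h : TriangleFreeOn G S) {v : V} (hv : v ∈ S) : IndepOn G (nbrsIn G S v) := by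
  intro a ha b hb hab
  rw [mem_nbrsIn] at ha hb
  exact h v hv a ha.1 b hb.1 ha.2 hab hb.2

lemma colorOn_empty (k : ℕ) : ColorOn G ∅ k :=
  ⟨fun _ => 0, by simp, by simp⟩

variable [DecidableEq V]

lemma ColorOn.add_indepOn {S I : Finset V} {k : ℕ} (hI : IndepOn G I)
    (h : ColorOn G (S \ I) k) : ColorOn G S (k + 1) := by
  obtain ⟨c, hc, hc'⟩ := h
  refine ⟨fun v => if v ∈ I then k else c v, fun v hv => ?_, fun u hu v hv huv => ?_⟩
  · by_cases hvI : v ∈ I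
    · simp [hvI]
    · simpa [hvI] using (hc v (Finset.mem_sdiff.2 ⟨hv, hvI⟩)).trans (Nat.lt_succ_self k)
  · by_cases huI : u ∈ I <;> by_cases hvI : v ∈ I
    · exact absurd huv (hI u huI v hvI)
    · simpa [huI, hvI] using (hc v (Finset.mem_sdiff.2 ⟨hv, hvI⟩)).ne'
    · simpa [huI, hvI] using (hc u (Finset.mem_sdiff.2 ⟨hu, huI⟩)).ne
    · simpa [huI, hvI] using
        hc' u (Finset.mem_sdiff.2 ⟨hu, huI⟩) v (Finset.mem_sdiff.2 ⟨hv, hvI⟩) huv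

variable [DecidableRel G.Adj]

lemma ColorOn.of_erase {S : Finset V} {k : ℕ} {v : V}
    (hdeg : (nbrsIn G S v).card < k) (h : ColorOn G (S.erase v) k) : ColorOn G S k := by
  obtain ⟨c, hc, hc'⟩ := h
  obtain ⟨x, hxk, hx⟩ : ∃ x ∈ Finset.range k, x ∉ (nbrsIn G S v).image c := by
    apply Finset.exists_mem_notMem_of_card_lt_card
    exact Finset.card_image_le.trans_lt (by simpa using hdeg)
  have hx' : ∀ u ∈ S, G.Adj v u → c u ≠ x := fun u hu huv hcx =>
    hx (Finset.mem_image.2 ⟨u, mem_nbrsIn.2 ⟨hu, huv⟩, hcx⟩)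
  refine ⟨Function.update c v x, fun u hu => ?_, fun a ha b hb hab => ?_⟩
  · by_cases huv : u = v
    · simpa [huv] using hxk
    · simpa [huv] using hc u (Finset.mem_erase.2 ⟨huv, hu⟩)
  · by_cases hav : a = v <;> by_cases hbv : b = v
    · exact absurd (hav.trans hbv.symm) hab.ne
    · subst hav
      simpa [hbv] using (hx' b hb hab).symm
    · subst hbv
      simpa [hav] using hx' a ha hab.symm
    · simpa [hav, hbv] using
        hc' a (Finset.mem_erase.2 ⟨hav, ha⟩) b (Finset.mem_erase.2 ⟨hbv, hb⟩) hab

omit [DecidableRel G.Adj] [DecidableEq V] in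
lemma exists_minimal_not_colorOn {S : Finset V} {k : ℕ} (h : ¬ ColorOn G S k) :
    ∃ T ⊆ S, ¬ ColorOn G T k ∧ ∀ U ⊂ T, ColorOn G U k := by
  induction S using Finset.strongInduction with
  | H S ih =>
    by_cases hS : ∀ U ⊂ S, ColorOn G U k
    · exact ⟨S, subset_rfl, h, hS⟩
    · push Not at hS
      obtain ⟨U, hU, hUk⟩ := hS
      obtain ⟨T, hTU, hT⟩ := ih U hU hUk
      exact ⟨T, hTU.trans hU.1, hT⟩

lemma le_card_nbrsIn_of_minimal {T : Finset V} {k : ℕ} (h : ¬ ColorOn G T k)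
    (hmin : ∀ U ⊂ T, ColorOn G U k) {v : V} (hv : v ∈ T) : k ≤ (nbrsIn G T v).card := by
  by_contra! hlt
  exact h (ColorOn.of_erase hlt (hmin _ (Finset.erase_ssubset hv)))

/-- A triangle-free graph of chromatic number above `k` has at least `1 + k (k + 1) / 2` vertices:
the neighborhood of a vertex of a vertex-critical subgraph is a color class of size `k`. -/
lemma TriangleFreeOn.two_mul_card_ge {S : Finset V} (hS : TriangleFreeOn G S) {k : ℕ}
    (h : ¬ ColorOn G S k) : k * (k + 1) + 2 ≤ 2 * S.card := by
  induction k generalizing S with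
  | zero =>
    have : S.Nonempty := by
      by_contra hne
      rw [Finset.not_nonempty_iff_eq_empty] at hne
      exact h (hne ▸ colorOn_empty 0)
    have := this.card_pos
    omega
  | succ k ih =>
    obtain ⟨T, hTS, hT, hmin⟩ := exists_minimal_not_colorOn h
    have hTne : T.Nonempty := by
      by_contra hne
      rw [Finset.not_nonempty_iff_eq_empty] at hne
      exact hT (hne ▸ colorOn_empty _)
    obtain ⟨v, hv⟩ := hTne
    have hdeg := le_card_nbrsIn_of_minimal hT hmin hv
    have hT3 := hS.mono hTS
    have hrest : ¬ ColorOn G (T \ nbrsIn G T v) k := fun hc =>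
      hT (hc.add_indepOn (hT3.indepOn_nbrsIn hv))
    have := ih (hT3.mono Finset.sdiff_subset) hrest
    have hcard := Finset.card_sdiff_add_card_eq_card (nbrsIn_subset (G := G) T v)
    have := Finset.card_le_card hTS
    nlinarith

end Coloring
section HarmonicWeight

/-- The weight of a vertex of degree `d` in the lower bound for the independence number. -/
noncomputable def harmonicWeight (d : ℕ) : ℝ :=
  2 / 5 * (((harmonic d : ℚ) : ℝ) + 3 / 2) / (d + 1)

lemma harmonic_succ_real (d : ℕ) :
    ((harmonic (d + 1) : ℚ) : ℝ) = (harmonic d : ℚ) + 1 / (d + 1) := by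
  rw [harmonic_succ]
  push_cast
  rw [one_div]

lemma one_le_harmonic_succ (d : ℕ) : (1 : ℝ) ≤ (harmonic (d + 1) : ℚ) := by
  induction d with
  | zero => rw [harmonic_succ_real]; simp
  | succ d ih =>
    rw [harmonic_succ_real]
    have : (0 : ℝ) ≤ 1 / ((d + 1 : ℕ) + 1) := by positivity
    linarith

lemma harmonic_succ_le (d : ℕ) : ((harmonic (d + 1) : ℚ) : ℝ) ≤ (d + 2) / 2 := by
  induction d with
  | zero => rw [harmonic_succ_real]; simp
  | succ d ih =>
    rw [harmonic_succ_real]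
    have : (1 : ℝ) / ((d + 1 : ℕ) + 1) ≤ 1 / 2 := by
      apply one_div_le_one_div_of_le (by norm_num)
      push_cast
      have : (0 : ℝ) ≤ d := Nat.cast_nonneg d
      linarith
    push_cast at this ⊢
    linarith

lemma harmonicWeight_sub (d : ℕ) :
    harmonicWeight d - harmonicWeight (d + 1) =
      2 / 5 * ((((harmonic (d + 1) : ℚ) : ℝ) + 3 / 2) / ((d + 1) * (d + 2)) - 1 / (d + 1) ^ 2) := by
  rw [harmonicWeight, harmonicWeight, harmonic_succ_real]
  push_cast
  field_simp
  ring

lemma harmonicWeight_sub_nonneg (d : ℕ) : 0 ≤ harmonicWeight d - harmonicWeight (d + 1) := by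
  rw [harmonicWeight_sub]
  have h := one_le_harmonic_succ d
  have hd : (0 : ℝ) ≤ d := Nat.cast_nonneg d
  have : (1 : ℝ) / (d + 1) ^ 2 ≤ (((harmonic (d + 1) : ℚ) : ℝ) + 3 / 2) / ((d + 1) * (d + 2)) := by
    rw [div_le_div_iff₀ (by positivity) (by positivity)]
    have : 0 ≤ (((harmonic (d + 1) : ℚ) : ℝ) - 1) * (d + 1) ^ 2 := by
      apply mul_nonneg <;> [linarith; positivity]
    nlinarith
  linarith

lemma harmonicWeight_antitone : Antitone harmonicWeight :=
  antitone_nat_of_succ_le fun d => by linarith [harmonicWeight_sub_nonneg d]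

lemma harmonicWeight_sub_antitone :
    Antitone fun d => harmonicWeight d - harmonicWeight (d + 1) := by
  refine antitone_nat_of_succ_le fun d => ?_
  rw [harmonicWeight_sub, harmonicWeight_sub, harmonic_succ_real (d + 1)]
  have h := one_le_harmonic_succ d
  have hd : (0 : ℝ) ≤ d := Nat.cast_nonneg d
  set H := ((harmonic (d + 1) : ℚ) : ℝ)
  push_cast
  rw [← sub_nonneg]
  have key : 2 / 5 * ((H + 3 / 2) / (((d : ℝ) + 1) * (d + 2)) - 1 / ((d : ℝ) + 1) ^ 2) -
      2 / 5 * ((H + 1 / ((d : ℝ) + 1 + 1) + 3 / 2) / (((d : ℝ) + 1 + 1) * (d + 1 + 2)) -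
        1 / ((d : ℝ) + 1 + 1) ^ 2) =
      2 / 5 * ((2 * (H + 3 / 2) * (d + 1) * (d + 2) - (3 * d + 5) * (d + 2)) /
        ((d + 1) ^ 2 * (d + 2) ^ 2 * (d + 3))) := by
    have h1 : (d : ℝ) + 1 ≠ 0 := by positivity
    have h2 : (d : ℝ) + 1 + 1 ≠ 0 := by positivity
    have h3 : (d : ℝ) + 2 ≠ 0 := by positivity
    have h4 : (d : ℝ) + 1 + 2 ≠ 0 := by positivity
    have h5 : (d : ℝ) + 3 ≠ 0 := by positivity
    have e2 : (d : ℝ) + 1 + 1 = d + 2 := by ring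
    have e3 : (d : ℝ) + 1 + 2 = d + 3 := by ring
    rw [e2, e3]
    field_simp
    ring
  rw [key]
  apply mul_nonneg (by norm_num)
  apply div_nonneg _ (by positivity)
  have : 0 ≤ (H - 1) * ((d + 1) * (d + 2)) := by
    apply mul_nonneg <;> [linarith; positivity]
  nlinarith

lemma harmonicWeight_zero_le_one : harmonicWeight 0 ≤ 1 := by
  norm_num [harmonicWeight]

/-- Deleting a vertex of degree `d + 1` with its neighbors does not decrease the weight bound on
average. -/
lemma harmonicWeight_recursion (d : ℕ) :
    ((d : ℝ) + 2) * harmonicWeight (d + 1) ≤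
      1 + (d + 1) * d * (harmonicWeight d - harmonicWeight (d + 1)) := by
  rw [harmonicWeight_sub, harmonicWeight]
  have h := harmonic_succ_le d
  have hd : (0 : ℝ) ≤ d := Nat.cast_nonneg d
  have hd' : (0 : ℝ) ≤ d * (d - 1) := by
    rcases Nat.eq_zero_or_pos d with rfl | hpos
    · simp
    · have : (1 : ℝ) ≤ d := by exact_mod_cast hpos
      exact mul_nonneg hd (by linarith)
  set H := ((harmonic (d + 1) : ℚ) : ℝ)
  push_cast
  rw [← sub_nonneg]
  have key : 1 + (d + 1) * d * (2 / 5 * ((H + 3 / 2) / (((d : ℝ) + 1) * (d + 2)) -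
      1 / ((d : ℝ) + 1) ^ 2)) -
      ((d : ℝ) + 2) * (2 / 5 * (H + 3 / 2) / ((d : ℝ) + 1 + 1)) =
      ((d + 1) * (d + 2) - 2 / 5 * (2 * (H + 3 / 2) * (d + 1) + d * (d + 2))) /
        ((d + 1) * (d + 2)) := by
    have e2 : (d : ℝ) + 1 + 1 = d + 2 := by ring
    rw [e2]
    field_simp
    ring
  rw [key]
  apply div_nonneg _ (by positivity)
  have : 0 ≤ ((d + 2) / 2 - H) * (d + 1) := by
    apply mul_nonneg <;> linarith
  nlinarith

lemma log_le_harmonicWeight (d : ℕ) :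
    2 / 5 * (Real.log (d + 1) + 3 / 2) / (d + 1) ≤ harmonicWeight d := by
  have h := log_add_one_le_harmonic d
  push_cast at h
  unfold harmonicWeight
  gcongr

end HarmonicWeight
lemma harmonicWeight_tangent (D d : ℕ) :
    harmonicWeight (D + 1) + ((D : ℝ) + 1 - d) * (harmonicWeight D - harmonicWeight (D + 1)) ≤
      harmonicWeight d := by
  set s := harmonicWeight D - harmonicWeight (D + 1) with hs
  rcases le_total (D + 1) d with hd | hd
  · induction d, hd using Nat.le_induction with
    | base => push_cast; linarith
    | succ d hd ih =>
      have := harmonicWeight_sub_antitone (show D ≤ d by omega)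
      simp only at this
      push_cast
      linarith
  · have hdown : ∀ j ≤ D + 1, harmonicWeight (D + 1) + j * s ≤ harmonicWeight (D + 1 - j) := by
      intro j hj
      induction j with
      | zero => simp
      | succ j ih =>
        have h1 := ih (by omega)
        have h2 := harmonicWeight_sub_antitone (show D + 1 - (j + 1) ≤ D by omega)
        simp only at h2
        rw [show D + 1 - (j + 1) + 1 = D + 1 - j by omega] at h2
        rw [Nat.cast_succ]
        linarith
    have := hdown (D + 1 - d) (by omega)
    rw [Nat.sub_sub_self hd, Nat.cast_sub hd] at this
    push_cast at this
    exact this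

section IndependenceNumber

variable {V : Type*} {G : SimpleGraph V} [DecidableEq V] [DecidableRel G.Adj]

/-- The edge decrement of the weight bound at degree `d`. -/
noncomputable def weightDrop (d : ℕ) : ℝ :=
  harmonicWeight (d - 1) - harmonicWeight d

lemma harmonicWeight_sub_le {d e : ℕ} (he : e ≤ d) :
    harmonicWeight d + e * weightDrop d ≤ harmonicWeight (d - e) := by
  cases d with
  | zero =>
    obtain rfl : e = 0 := by omega
    simp
  | succ d =>
    have := harmonicWeight_tangent d (d + 1 - e)
    rw [Nat.cast_sub he] at this
    push_cast at this
    simpa [weightDrop] using this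

lemma weightDrop_mul_sub_nonneg {a b : ℕ} (ha : 0 < a) (hb : 0 < b) :
    0 ≤ (weightDrop a - weightDrop b) * ((b : ℝ) - a) := by
  obtain ⟨a, rfl⟩ := Nat.exists_eq_add_of_lt ha
  obtain ⟨b, rfl⟩ := Nat.exists_eq_add_of_lt hb
  simp only [weightDrop, zero_add, Nat.add_sub_cancel]
  rcases le_total a b with h | h
  · have h1 := harmonicWeight_sub_antitone h
    have h2 : (a : ℝ) ≤ b := by exact_mod_cast h
    simp only at h1
    apply mul_nonneg
    · linarith
    · push_cast; linarith
  · have h1 := harmonicWeight_sub_antitone h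
    have h2 : (b : ℝ) ≤ a := by exact_mod_cast h
    simp only at h1
    apply mul_nonneg_of_nonpos_of_nonpos
    · linarith
    · push_cast; linarith

lemma weight_balance_nonneg (d : ℕ) :
    0 ≤ 1 - harmonicWeight d - d * harmonicWeight d - d * weightDrop d +
      d * (d * weightDrop d) := by
  cases d with
  | zero => simpa using harmonicWeight_zero_le_one
  | succ d =>
    have := harmonicWeight_recursion d
    simp only [weightDrop, Nat.add_sub_cancel]
    push_cast
    nlinarith

omit [DecidableEq V] in
lemma card_nbrsIn_eq_sum (S : Finset V) (v : V) :
    ((nbrsIn G S v).card : ℝ) = ∑ u ∈ S, if G.Adj v u then (1 : ℝ) else 0 := by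
  simp [nbrsIn]

omit [DecidableEq V] in
lemma sum_nbrsIn_eq_sum (S : Finset V) (v : V) (φ : V → ℝ) :
    ∑ u ∈ nbrsIn G S v, φ u = ∑ u ∈ S, (if G.Adj v u then (1 : ℝ) else 0) * φ u := by
  simp [nbrsIn, Finset.sum_filter]

omit [DecidableEq V] in
lemma sum_sum_nbrsIn (S : Finset V) (φ : V → ℝ) :
    ∑ v ∈ S, ∑ u ∈ nbrsIn G S v, φ u = ∑ v ∈ S, (nbrsIn G S v).card * φ v := by
  simp_rw [sum_nbrsIn_eq_sum, card_nbrsIn_eq_sum, Finset.sum_mul]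
  rw [Finset.sum_comm]
  simp_rw [G.adj_comm]

lemma sum_sum_common_nbrsIn (S : Finset V) (φ : V → ℝ) :
    ∑ v ∈ S, ∑ w ∈ S, ((nbrsIn G S w ∩ nbrsIn G S v).card : ℝ) * φ w =
      ∑ w ∈ S, ∑ u ∈ nbrsIn G S w, φ w * (nbrsIn G S u).card := by
  have h : ∀ v w, ((nbrsIn G S w ∩ nbrsIn G S v).card : ℝ) =
      ∑ u ∈ nbrsIn G S w, if G.Adj u v then (1 : ℝ) else 0 := by
    intro v w
    rw [Finset.sum_boole]
    congr 2
    ext u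
    simp only [Finset.mem_inter, mem_nbrsIn, Finset.mem_filter, G.adj_comm v u]
    tauto
  simp_rw [h]
  rw [Finset.sum_comm]
  refine Finset.sum_congr rfl fun w _ => ?_
  simp_rw [Finset.sum_mul]
  rw [Finset.sum_comm]
  refine Finset.sum_congr rfl fun u _ => ?_
  rw [card_nbrsIn_eq_sum, ← Finset.sum_mul, mul_comm]

omit [DecidableEq V] in
lemma sum_weightDrop_le (S : Finset V) :
    ∑ w ∈ S, ((nbrsIn G S w).card : ℝ) * ((nbrsIn G S w).card *
        weightDrop (nbrsIn G S w).card) ≤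
      ∑ w ∈ S, ∑ u ∈ nbrsIn G S w,
        weightDrop (nbrsIn G S w).card * (nbrsIn G S u).card := by
  set d : V → ℕ := fun v => (nbrsIn G S v).card with hd
  have hpos : 0 ≤ ∑ w ∈ S, ∑ u ∈ nbrsIn G S w,
      (weightDrop (d w) - weightDrop (d u)) * ((d u : ℝ) - d w) := by
    refine Finset.sum_nonneg fun w hw => Finset.sum_nonneg fun u hu => ?_
    rw [mem_nbrsIn] at hu
    apply weightDrop_mul_sub_nonneg
    · exact Finset.card_pos.2 ⟨u, mem_nbrsIn.2 hu⟩
    · exact Finset.card_pos.2 ⟨w, mem_nbrsIn.2 ⟨hw, hu.2.symm⟩⟩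
  have hsymm : ∀ ψ : V → V → ℝ, ∑ w ∈ S, ∑ u ∈ nbrsIn G S w, ψ w u =
      ∑ w ∈ S, ∑ u ∈ nbrsIn G S w, ψ u w := by
    intro ψ
    simp_rw [sum_nbrsIn_eq_sum]
    rw [Finset.sum_comm]
    simp_rw [G.adj_comm]
  have e1 := hsymm fun w u => weightDrop (d w) * d u
  have e2 := hsymm fun w u => weightDrop (d w) * d w
  have e3 : ∑ w ∈ S, ∑ u ∈ nbrsIn G S w, weightDrop (d w) * d w =
      ∑ w ∈ S, (d w : ℝ) * (d w * weightDrop (d w)) := by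
    refine Finset.sum_congr rfl fun w _ => ?_
    rw [Finset.sum_const, nsmul_eq_mul, mul_comm (weightDrop _)]
  have hexp : ∑ w ∈ S, ∑ u ∈ nbrsIn G S w,
      (weightDrop (d w) - weightDrop (d u)) * ((d u : ℝ) - d w) =
      ∑ w ∈ S, ∑ u ∈ nbrsIn G S w, weightDrop (d w) * d u +
      ∑ w ∈ S, ∑ u ∈ nbrsIn G S w, weightDrop (d u) * d w -
      ∑ w ∈ S, ∑ u ∈ nbrsIn G S w, weightDrop (d w) * d w -
      ∑ w ∈ S, ∑ u ∈ nbrsIn G S w, weightDrop (d u) * d u := by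
    simp_rw [← Finset.sum_add_distrib, ← Finset.sum_sub_distrib]
    refine Finset.sum_congr rfl fun w _ => Finset.sum_congr rfl fun u _ => ?_
    ring
  rw [hexp] at hpos
  linarith

/-- Shearer's argument: a triangle-free graph has an independent set of size at least the sum of
the weights of its vertex degrees. -/
lemma TriangleFreeOn.exists_indepOn_sum_le {S : Finset V} (hS : TriangleFreeOn G S) :
    ∃ I ⊆ S, IndepOn G I ∧ ∑ v ∈ S, harmonicWeight (nbrsIn G S v).card ≤ I.card := by
  induction S using Finset.strongInduction with
  | H S ih =>
    rcases S.eq_empty_or_nonempty with rfl | hne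
    · exact ⟨∅, subset_rfl, by simp [IndepOn], by simp⟩
    set d : V → ℕ := fun v => (nbrsIn G S v).card with hd
    set R : V → Finset V := fun v => S \ insert v (nbrsIn G S v) with hR
    set e : V → V → ℝ := fun v w => ((nbrsIn G S w ∩ nbrsIn G S v).card : ℝ) with he
    have hnotmem : ∀ v, v ∉ nbrsIn G S v := fun v h => G.loopless.irrefl v (mem_nbrsIn.1 h).2
    have hsplit : ∀ v ∈ S, ∀ φ : V → ℝ, ∑ w ∈ S, φ w =
        ∑ w ∈ R v, φ w + (φ v + ∑ w ∈ nbrsIn G S v, φ w) := by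
      intro v hv φ
      rw [← Finset.sum_insert (hnotmem v), hR, Finset.sum_sdiff]
      exact Finset.insert_subset hv (nbrsIn_subset S v)
    have hdrop : ∀ v ∈ S, ∑ w ∈ R v, e v w * weightDrop (d w) =
        ∑ w ∈ S, e v w * weightDrop (d w) - d v * weightDrop (d v) := by
      intro v hv
      have hzero : ∑ w ∈ nbrsIn G S v, e v w * weightDrop (d w) = 0 := by
        refine Finset.sum_eq_zero fun w hw => ?_
        rw [mem_nbrsIn] at hw
        have : nbrsIn G S w ∩ nbrsIn G S v = ∅ := by
          rw [Finset.eq_empty_iff_forall_notMem]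
          intro x hx
          rw [Finset.mem_inter, mem_nbrsIn, mem_nbrsIn] at hx
          exact hS v hv w hw.1 x hx.1.1 hw.2 hx.1.2 hx.2.2
        simp [he, this]
      rw [hsplit v hv, hzero]
      simp [he, hd]
    obtain ⟨v, hv, hgood⟩ : ∃ v ∈ S, harmonicWeight (d v) +
        ∑ u ∈ nbrsIn G S v, harmonicWeight (d u) ≤
          1 + ∑ w ∈ R v, e v w * weightDrop (d w) := by
      apply Finset.exists_le_of_sum_le hne
      rw [Finset.sum_add_distrib, Finset.sum_add_distrib, Finset.sum_congr rfl hdrop,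
        Finset.sum_sub_distrib, sum_sum_common_nbrsIn, sum_sum_nbrsIn]
      have h1 := sum_weightDrop_le (G := G) S
      have h2 := Finset.sum_nonneg fun v (_ : v ∈ S) => weight_balance_nonneg (d v)
      simp only [Finset.sum_add_distrib, Finset.sum_sub_distrib] at h2
      linarith
    have hRS : R v ⊂ S := by
      refine Finset.sdiff_ssubset (Finset.insert_subset hv (nbrsIn_subset S v)) ⟨v, by simp⟩
    have hdeg : ∀ w ∈ R v, harmonicWeight (d w) + e v w * weightDrop (d w) ≤
        harmonicWeight (nbrsIn G (R v) w).card := by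
      intro w hw
      have hw' : w ∈ S ∧ ¬ (w = v ∨ w ∈ nbrsIn G S v) := by
        simpa [hR, Finset.mem_sdiff] using hw
      have hvw : ¬ G.Adj w v := fun h => hw'.2 (Or.inr (mem_nbrsIn.2 ⟨hw'.1, h.symm⟩))
      have hset : nbrsIn G (R v) w = nbrsIn G S w \ nbrsIn G S v := by
        ext x
        simp only [hR, mem_nbrsIn, Finset.mem_sdiff, Finset.mem_insert]
        constructor
        · rintro ⟨⟨h1, h2⟩, h3⟩
          exact ⟨⟨h1, h3⟩, fun h => h2 (Or.inr h)⟩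
        · rintro ⟨⟨h1, h3⟩, h2⟩
          refine ⟨⟨h1, ?_⟩, h3⟩
          rintro (rfl | h)
          · exact hvw h3
          · exact h2 h
      rw [hset, Finset.card_sdiff, Finset.inter_comm]
      exact harmonicWeight_sub_le (Finset.card_le_card Finset.inter_subset_left)
    obtain ⟨I, hIR, hI, hcard⟩ := ih (R v) hRS (hS.mono hRS.1)
    have hIv : ∀ u ∈ I, u ≠ v ∧ ¬ G.Adj v u := by
      intro u hu
      have := hIR hu
      simp only [hR, Finset.mem_sdiff, Finset.mem_insert, mem_nbrsIn] at this
      tauto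
    have hvI : v ∉ I := fun h => (hIv v h).1 rfl
    refine ⟨insert v I, Finset.insert_subset hv (hIR.trans hRS.1), ?_, ?_⟩
    · intro a ha b hb hab
      rw [Finset.mem_insert] at ha hb
      rcases ha with rfl | ha <;> rcases hb with rfl | hb
      · exact hab.ne rfl
      · exact (hIv b hb).2 hab
      · exact (hIv a ha).2 hab.symm
      · exact hI a ha b hb hab
    · rw [Finset.card_insert_of_notMem hvI, hsplit v hv]
      have h3 := Finset.sum_le_sum hdeg
      rw [Finset.sum_add_distrib] at h3
      push_cast
      linarith

end IndependenceNumber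
section ChromaticBounds

variable {V : Type*} {G : SimpleGraph V} [DecidableEq V] [DecidableRel G.Adj]

lemma TriangleFreeOn.exists_indepOn_sqrt_le {S : Finset V} (hS : TriangleFreeOn G S)
    (hlog : 8 ≤ Real.log S.card) :
    ∃ I ⊆ S, IndepOn G I ∧ √(S.card * Real.log S.card / 5) ≤ I.card := by
  set N : ℝ := (S.card : ℝ) with hN
  have hN0 : 0 < N := by
    rcases (Nat.cast_nonneg S.card : (0 : ℝ) ≤ S.card).eq_or_lt with h | h
    · rw [hN, ← h, Real.log_zero] at hlog
      norm_num at hlog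
    · exact h
  set s := √(N * Real.log N / 5) with hs
  have hs2 : s ^ 2 = N * Real.log N / 5 := Real.sq_sqrt (by positivity)
  have hs0 : 0 < s := Real.sqrt_pos.2 (by positivity)
  by_cases hbig : ∃ v ∈ S, s ≤ (nbrsIn G S v).card
  · obtain ⟨v, hv, hsv⟩ := hbig
    exact ⟨_, nbrsIn_subset S v, hS.indepOn_nbrsIn hv, hsv⟩
  push Not at hbig
  obtain ⟨I, hIS, hI, hsum⟩ := hS.exists_indepOn_sum_le
  refine ⟨I, hIS, hI, le_trans ?_ hsum⟩
  have h1 : N * harmonicWeight ⌊s⌋₊ ≤ ∑ v ∈ S, harmonicWeight (nbrsIn G S v).card := by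
    rw [hN, ← nsmul_eq_mul]
    exact Finset.card_nsmul_le_sum _ _ _ fun v hv =>
      harmonicWeight_antitone (Nat.le_floor (hbig v hv).le)
  have h2 := log_le_harmonicWeight ⌊s⌋₊
  have hfl : (⌊s⌋₊ : ℝ) ≤ s := Nat.floor_le hs0.le
  have hfl' : s < ⌊s⌋₊ + 1 := Nat.lt_floor_add_one s
  have hlogs : Real.log N / 2 ≤ Real.log s := by
    have e : 2 * Real.log s = Real.log N + Real.log (Real.log N / 5) := by
      rw [← Real.log_mul hN0.ne' (by positivity), ← mul_div_assoc, ← hs2, Real.log_pow]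
      norm_num
    have : 0 ≤ Real.log (Real.log N / 5) := Real.log_nonneg (by linarith)
    linarith
  have hlogs' : Real.log s ≤ Real.log (⌊s⌋₊ + 1) := Real.log_le_log hs0 hfl'.le
  have hsN : s ≤ 3 / 5 * N := by
    apply Real.sqrt_le_iff.2 ⟨by positivity, ?_⟩
    have : Real.log N ≤ N - 1 := Real.log_le_sub_one_of_pos hN0
    nlinarith
  refine le_trans ?_ (le_trans (mul_le_mul_of_nonneg_left h2 hN0.le) h1)
  rw [← mul_div_assoc, le_div_iff₀ (by positivity)]
  nlinarith [mul_le_mul_of_nonneg_left hfl hs0.le,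
    mul_le_mul_of_nonneg_left (hlogs.trans hlogs') hN0.le]

omit [DecidableRel G.Adj] in
/-- Greedy coloring when independent sets of order `√|H|` are available in large sets `H`. -/
lemma TriangleFreeOn.succ_le_of_sqrt_indepOn {S : Finset V} (hS : TriangleFreeOn G S) {γ N₀ : ℝ}
    (hγ : 0 < γ) (hN₀ : 1 ≤ N₀)
    (hI : ∀ H ⊆ S, N₀ < H.card → ∃ I ⊆ H, IndepOn G I ∧ γ * √H.card ≤ I.card) {k : ℕ}
    (h : ¬ ColorOn G S k) : (k : ℝ) + 1 ≤ 2 / γ * √S.card + 2 * √N₀ := by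
  classical
  induction S using Finset.strongInduction generalizing k with
  | H S ih =>
    have hN₀' : 1 ≤ √N₀ := Real.one_le_sqrt.2 hN₀
    have hpos : 0 ≤ 2 / γ * √S.card := by positivity
    by_cases hsmall : (S.card : ℝ) ≤ N₀
    · have hk : ((k * (k + 1) + 2 : ℕ) : ℝ) ≤ ((2 * S.card : ℕ) : ℝ) :=
        Nat.cast_le.2 (hS.two_mul_card_ge h)
      push_cast at hk
      have : ((k : ℝ) + 1) / 2 ≤ √N₀ := by
        apply Real.le_sqrt_of_sq_le
        nlinarith [sq_nonneg ((k : ℝ) - 1)]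
      linarith
    push Not at hsmall
    cases k with
    | zero => push_cast; linarith
    | succ k =>
      obtain ⟨I, hIS, hind, hcard⟩ := hI S subset_rfl hsmall
      have hS0 : 0 < √(S.card : ℝ) := Real.sqrt_pos.2 (by linarith)
      have hI0 : 0 < I.card := by
        have : (0 : ℝ) < I.card := lt_of_lt_of_le (by positivity) hcard
        exact_mod_cast this
      have hsub : S \ I ⊂ S := Finset.sdiff_ssubset hIS (Finset.card_pos.1 hI0)
      have hrec := ih _ hsub (hS.mono hsub.1) (fun H hH => hI H (hH.trans hsub.1))
        fun hc => h (hc.add_indepOn hind)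
      have hdiff : ((S \ I).card : ℝ) + I.card = S.card := by
        exact_mod_cast Finset.card_sdiff_add_card_eq_card hIS
      have hsq : √((S \ I).card : ℝ) ≤ √S.card - γ / 2 := by
        have hss : √(S.card : ℝ) ^ 2 = S.card := Real.sq_sqrt (Nat.cast_nonneg _)
        have hle : (I.card : ℝ) ≤ S.card := by
          exact_mod_cast Finset.card_le_card hIS
        apply Real.sqrt_le_iff.2
        constructor
        · nlinarith
        · nlinarith
      have : 2 / γ * √((S \ I).card : ℝ) ≤ 2 / γ * √S.card - 1 := by
        calc 2 / γ * √((S \ I).card : ℝ) ≤ 2 / γ * (√S.card - γ / 2) := by gcongr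
          _ = 2 / γ * √S.card - 1 := by field_simp
      push_cast
      linarith

lemma TriangleFreeOn.succ_le_sqrt_div_log {S : Finset V} (hS : TriangleFreeOn G S) {x : ℝ}
    (hx : 16 ≤ Real.log x) (hx0 : 0 < x) (hSx : S.card ≤ x) {k : ℕ} (h : ¬ ColorOn G S k) :
    (k : ℝ) + 1 ≤ 8 * √(x / Real.log x) := by
  set L := Real.log x with hL
  have hsx0 : 0 < √x := Real.sqrt_pos.2 hx0
  have hlogsqrt : Real.log (√x) = L / 2 := Real.log_sqrt hx0.le
  have hexp : √x = Real.exp (L / 2) := by rw [← hlogsqrt, Real.exp_log hsx0]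
  have hquad : 1 + L / 2 + (L / 2) ^ 2 / 2 ≤ √x := by
    rw [hexp]; exact Real.quadratic_le_exp_of_nonneg (by linarith)
  have hγ : 0 < √(L / 10) := Real.sqrt_pos.2 (by linarith)
  have key := hS.succ_le_of_sqrt_indepOn (γ := √(L / 10)) (N₀ := √x) hγ (by nlinarith) ?_ h
  · have h1 : 2 / √(L / 10) * √(S.card : ℝ) ≤ 32 / 5 * √(x / L) := by
      rw [div_mul_eq_mul_div, div_le_iff₀ hγ, mul_assoc, ← Real.sqrt_mul (by positivity)]
      rw [show x / L * (L / 10) = x / 10 by field_simp]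
      have : √(S.card : ℝ) ≤ 16 / 5 * √(x / 10) := by
        apply Real.sqrt_le_iff.2 ⟨by positivity, ?_⟩
        rw [mul_pow, Real.sq_sqrt (by positivity)]
        linarith
      linarith
    have h2 : √(√x) ≤ 4 / 5 * √(x / L) := by
      apply Real.sqrt_le_iff.2 ⟨by positivity, ?_⟩
      rw [mul_pow, Real.sq_sqrt (by positivity), ← mul_div_assoc, le_div_iff₀ (by linarith)]
      nlinarith [Real.sq_sqrt hx0.le]
    linarith
  · intro H hH hcard
    have hlogH : L / 2 ≤ Real.log H.card := by
      rw [← hlogsqrt]; exact Real.log_le_log hsx0 hcard.le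
    obtain ⟨I, hIH, hI, hle⟩ := (hS.mono hH).exists_indepOn_sqrt_le (by linarith)
    refine ⟨I, hIH, hI, le_trans ?_ hle⟩
    rw [← Real.sqrt_mul (by linarith)]
    apply Real.sqrt_le_sqrt
    have : (0 : ℝ) ≤ H.card := Nat.cast_nonneg _
    nlinarith

omit [DecidableRel G.Adj] in
/-- Greedy coloring when independent sets of order `|H| ^ 2` are available. -/
lemma exists_subset_of_sq_indepOn {S : Finset V} {β : ℝ} (hβ : 0 ≤ β)
    (hI : ∀ H ⊆ S, ∃ I ⊆ H, IndepOn G I ∧ β * (H.card : ℝ) ^ 2 ≤ I.card) {k : ℕ}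
    (h : ¬ ColorOn G S k) {t : ℕ} (ht : t ≤ k) :
    ∃ T ⊆ S, ¬ ColorOn G T (k - t) ∧ β * t * T.card ≤ 1 := by
  induction t with
  | zero => exact ⟨S, subset_rfl, by simpa using h, by simp⟩
  | succ t ih =>
    obtain ⟨T, hTS, hT, hcard⟩ := ih (by omega)
    obtain ⟨I, hIT, hind, hIcard⟩ := hI T hTS
    refine ⟨T \ I, Finset.sdiff_subset.trans hTS, fun hc => hT ?_, ?_⟩
    · have := hc.add_indepOn hind
      rwa [show k - (t + 1) + 1 = k - t by omega] at this
    · have hdiff : ((T \ I).card : ℝ) + I.card = T.card := by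
        exact_mod_cast Finset.card_sdiff_add_card_eq_card hIT
      have hle : (I.card : ℝ) ≤ T.card := by exact_mod_cast Finset.card_le_card hIT
      rcases (Nat.cast_nonneg T.card : (0 : ℝ) ≤ T.card).eq_or_lt with h0 | h0
      · have : ((T \ I).card : ℝ) = 0 := by
          have := (Nat.cast_nonneg I.card : (0 : ℝ) ≤ I.card)
          have := (Nat.cast_nonneg (T \ I).card : (0 : ℝ) ≤ (T \ I).card)
          linarith
        rw [this]; simp
      · have hy : β * T.card ≤ 1 := by
          by_contra! hlt
          nlinarith
        have hy0 : 0 ≤ β * T.card := by positivity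
        have hrest : ((T \ I).card : ℝ) ≤ T.card - β * (T.card : ℝ) ^ 2 := by linarith
        push_cast
        calc β * ((t : ℝ) + 1) * (T \ I).card
            ≤ β * ((t : ℝ) + 1) * (T.card - β * (T.card : ℝ) ^ 2) := by gcongr
          _ = (β * t * T.card + β * T.card) * (1 - β * T.card) := by ring
          _ ≤ (1 + β * T.card) * (1 - β * T.card) := by
            apply mul_le_mul_of_nonneg_right <;> linarith
          _ ≤ 1 := by nlinarith

end ChromaticBounds
section EdgeBound

variable {V : Type*} {G : SimpleGraph V} [DecidableEq V] [DecidableRel G.Adj]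

lemma TriangleFreeOn.exists_indepOn_sq_le {S : Finset V} (hS : TriangleFreeOn G S) {m L k : ℝ}
    (hm : ∑ v ∈ S, ((nbrsIn G S v).card : ℝ) ≤ 2 * m) (hk : 0 < k) (hSk : S.card * k ≤ 2 * m)
    (hL0 : 0 ≤ L) (hLk : L ≤ 3 * k) (hL : L / 4 ≤ Real.log k) :
    ∃ I ⊆ S, IndepOn G I ∧ L / (20 * m) * (S.card : ℝ) ^ 2 ≤ I.card := by
  rcases S.eq_empty_or_nonempty with rfl | hne
  · exact ⟨∅, subset_rfl, by simp [IndepOn], by simp⟩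
  obtain ⟨I, hIS, hI, hsum⟩ := hS.exists_indepOn_sum_le
  refine ⟨I, hIS, hI, le_trans ?_ hsum⟩
  set h : ℝ := (S.card : ℝ) with hh
  have hh0 : 0 < h := by rw [hh]; exact_mod_cast hne.card_pos
  have hm0 : 0 < m := by nlinarith [mul_pos hh0 hk]
  obtain ⟨D, hD⟩ : ∃ D, ⌈2 * m / h⌉₊ = D + 1 :=
    Nat.exists_eq_succ_of_ne_zero (Nat.ceil_pos.2 (by positivity)).ne'
  have hDlo : 2 * m / h ≤ D + 1 := by
    have := Nat.le_ceil (2 * m / h)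
    rw [hD] at this
    exact_mod_cast this
  have hDhi : (D : ℝ) + 1 < 2 * m / h + 1 := by
    have := Nat.ceil_lt_add_one (show 0 ≤ 2 * m / h by positivity)
    rw [hD] at this
    exact_mod_cast this
  have hjensen : h * harmonicWeight (D + 1) ≤
      ∑ v ∈ S, harmonicWeight (nbrsIn G S v).card := by
    have h1 := Finset.sum_le_sum fun v (_ : v ∈ S) =>
      harmonicWeight_tangent D (nbrsIn G S v).card
    rw [Finset.sum_add_distrib, ← Finset.sum_mul, Finset.sum_sub_distrib, Finset.sum_const,
      Finset.sum_const, nsmul_eq_mul, nsmul_eq_mul, ← hh] at h1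
    have h2 : 0 ≤ h * ((D : ℝ) + 1) - ∑ v ∈ S, ((nbrsIn G S v).card : ℝ) := by
      rw [div_le_iff₀ hh0] at hDlo
      linarith
    have h3 := mul_nonneg h2 (harmonicWeight_sub_nonneg D)
    linarith
  refine le_trans ?_ hjensen
  have hlog : L / 4 ≤ Real.log (((D + 1 : ℕ) : ℝ) + 1) := by
    refine hL.trans (Real.log_le_log hk ?_)
    have : k ≤ 2 * m / h := by rw [le_div_iff₀ hh0]; linarith
    push_cast
    linarith
  refine le_trans ?_ (mul_le_mul_of_nonneg_left (log_le_harmonicWeight (D + 1)) hh0.le)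
  push_cast at hlog ⊢
  have hnum : 0 ≤ 2 / 5 * (Real.log ((D : ℝ) + 1 + 1) + 3 / 2) := by linarith
  have hden : ((D : ℝ) + 1 + 1) ≤ 2 * (m + h) / h := by
    rw [show 2 * (m + h) / h = 2 * m / h + 2 by field_simp]
    linarith
  calc L / (20 * m) * h ^ 2 ≤ h * (2 / 5 * (L / 4 + 3 / 2) / (2 * (m + h) / h)) := by
        rw [show h * (2 / 5 * (L / 4 + 3 / 2) / (2 * (m + h) / h)) =
          (L / 4 + 3 / 2) / (5 * (m + h)) * h ^ 2 by field_simp]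
        apply mul_le_mul_of_nonneg_right _ (by positivity)
        rw [div_le_div_iff₀ (by positivity) (by positivity)]
        nlinarith
    _ ≤ _ := by gcongr

lemma TriangleFreeOn.succ_le_edge_bound {S : Finset V} (hS : TriangleFreeOn G S) {m M : ℝ}
    (hm : ∑ v ∈ S, ((nbrsIn G S v).card : ℝ) ≤ 2 * m) (hm1 : 1 < m) (hM : 0 < M)
    (hMm : M ^ 3 * Real.log m ^ 2 = m) {k : ℕ} (h : ¬ ColorOn G S k) :
    (k : ℝ) + 1 ≤ 28 * M := by
  by_contra! hk
  set L := Real.log m with hL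
  have hL0 : 0 < L := Real.log_pos hm1
  have hm0 : 0 < m := by linarith
  have hM1 : 1 ≤ M := by
    have h1 := Real.quadratic_le_exp_of_nonneg (show 0 ≤ L / 2 by positivity)
    have h2 : Real.exp (L / 2) ^ 2 = m := by
      rw [← Real.exp_nat_mul, ← Real.exp_log hm0]
      congr 1
      push_cast
      ring
    have h3 : L ≤ Real.exp (L / 2) := by nlinarith [sq_nonneg (L - 2)]
    have h4 : L ^ 2 ≤ M ^ 3 * L ^ 2 := by
      rw [hMm, ← h2]
      exact pow_le_pow_left₀ hL0.le h3 2
    have h5 : 1 ≤ M ^ 3 := by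
      by_contra! hlt
      nlinarith [pow_pos hL0 2]
    by_contra! hlt
    exact absurd h5 (not_le.2 (pow_lt_one₀ hM.le hlt (by norm_num)))
  have hk27 : 27 * M ≤ k := by linarith
  obtain ⟨T, hTS, hT, hmin⟩ := exists_minimal_not_colorOn h
  have hT3 := hS.mono hTS
  have hsub : ∀ H ⊆ S, ∑ v ∈ H, ((nbrsIn G H v).card : ℝ) ≤ 2 * m := by
    intro H hH
    refine le_trans (le_trans ?_ (Finset.sum_le_sum_of_subset_of_nonneg hH ?_)) hm
    · refine Finset.sum_le_sum fun v _ => ?_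
      exact_mod_cast Finset.card_le_card (Finset.filter_subset_filter _ hH)
    · intros; positivity
  have hTk : (T.card : ℝ) * k ≤ 2 * m := by
    refine le_trans ?_ (hsub T hTS)
    rw [← nsmul_eq_mul]
    exact Finset.card_nsmul_le_sum _ _ _ fun v hv => by
      exact_mod_cast le_card_nbrsIn_of_minimal hT hmin hv
  have hcard : (k : ℝ) * (k + 1) + 2 ≤ 2 * T.card := by
    exact_mod_cast hT3.two_mul_card_ge hT
  have hL50 : 50 ≤ L := by
    have h1 : (k : ℝ) ^ 2 * (k + 1) ≤ 4 * m := by nlinarith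
    have h2 : (27 * M) ^ 2 * (28 * M) ≤ (k : ℝ) ^ 2 * (k + 1) := by gcongr
    have h3 : M ^ 3 * 5103 ≤ M ^ 3 * L ^ 2 := by rw [hMm]; nlinarith
    have h4 : 5103 ≤ L ^ 2 := le_of_mul_le_mul_left h3 (by positivity)
    nlinarith
  have hlogM : 3 * Real.log M + 2 * Real.log L = L := by
    conv_rhs => rw [hL, ← hMm, Real.log_mul (by positivity) (by positivity),
      Real.log_pow, Real.log_pow]
    push_cast
    ring
  have hlogL : Real.log L ≤ L / 8 := by
    have h1 := Real.log_le_sub_one_of_pos (show 0 < L / 16 by positivity)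
    have h2 : Real.log 16 = 4 * Real.log 2 := by
      rw [show (16 : ℝ) = 2 ^ 4 by norm_num, Real.log_pow]; norm_num
    rw [Real.log_div hL0.ne' (by norm_num), h2] at h1
    linarith [Real.log_two_lt_d9]
  have hlogM' : L / 4 ≤ Real.log M := by linarith
  have hML : L / 4 ≤ M := by linarith [Real.log_le_sub_one_of_pos hM]
  have hlogk : L / 4 ≤ Real.log k := hlogM'.trans (Real.log_le_log hM (by linarith))
  have ht9 : 9 * M ≤ (⌈9 * M⌉₊ : ℝ) := Nat.le_ceil _
  have ht9' : (⌈9 * M⌉₊ : ℝ) < 9 * M + 1 := Nat.ceil_lt_add_one (by positivity)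
  have htk : ⌈9 * M⌉₊ ≤ k := by
    have : (⌈9 * M⌉₊ : ℝ) ≤ k := by linarith
    exact_mod_cast this
  obtain ⟨U, hUT, hU, hUcard⟩ := exists_subset_of_sq_indepOn (β := L / (20 * m)) (by positivity)
    (fun H hH => (hT3.mono hH).exists_indepOn_sq_le (k := k) (hsub H (hH.trans hTS))
      (by linarith) (le_trans (by gcongr) hTk) hL0.le (by linarith) hlogk) hT htk
  set x := 20 / 9 * M ^ 2 * L with hx
  have hx0 : 0 < x := by positivity
  have hUx : (U.card : ℝ) ≤ x := by
    have h1 : L / (20 * m) * (9 * M) * U.card ≤ 1 := le_trans (by gcongr) hUcard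
    rw [← hMm] at h1
    have h2 : L / (20 * (M ^ 3 * L ^ 2)) * (9 * M) * U.card = U.card / x := by
      rw [hx]; field_simp
    rwa [h2, div_le_one hx0] at h1
  have hlogx : L / 2 ≤ Real.log x := by
    rw [hx, Real.log_mul (by positivity) hL0.ne', Real.log_mul (by norm_num) (by positivity),
      Real.log_pow]
    have : 0 ≤ Real.log (20 / 9 : ℝ) := Real.log_nonneg (by norm_num)
    push_cast
    linarith
  have hfin := (hT3.mono hUT).succ_le_sqrt_div_log (by linarith) hx0 hUx hU
  have hsq : √(x / Real.log x) ≤ 211 / 100 * M := by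
    apply Real.sqrt_le_iff.2 ⟨by positivity, ?_⟩
    calc x / Real.log x ≤ x / (L / 2) := by gcongr
      _ = 40 / 9 * M ^ 2 := by rw [hx]; field_simp; norm_num
      _ ≤ (211 / 100 * M) ^ 2 := by nlinarith [sq_nonneg M]
  rw [Nat.cast_sub htk] at hfin
  linarith

end EdgeBound
section BullDiamond

variable {V : Type*} {G : SimpleGraph V}

lemma IsIndFree.not_adj_iff {W : Type*} {H : SimpleGraph W} (h : IsIndFree G H) {f : W → V}
    (hf : Function.Injective f) : ¬ ∀ i j, G.Adj (f i) (f j) ↔ H.Adj i j := fun hadj =>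
  h (Set.range f) ⟨⟨Equiv.ofInjective f hf, by intro i j; simpa using hadj i j⟩⟩

lemma IsIndFree.adj_of_diamond (h : IsIndFree G diamond) {a b c d : V} (hab : a ≠ b)
    (hcd : G.Adj c d) (hac : G.Adj a c) (had : G.Adj a d) (hbc : G.Adj b c) (hbd : G.Adj b d) :
    G.Adj a b := by
  by_contra hnab
  refine h.not_adj_iff (f := ![a, b, c, d]) ?_ ?_
  · intro i j
    fin_cases i <;> fin_cases j <;>
      simp [hab, hab.symm, hcd.ne, hcd.ne', hac.ne, hac.ne', had.ne, had.ne', hbc.ne, hbc.ne',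
        hbd.ne, hbd.ne']
  · intro i j
    fin_cases i <;> fin_cases j <;>
      simp [diamond, hnab, hcd, hac, had, hbc, hbd, hcd.symm, hac.symm, had.symm, hbc.symm,
        hbd.symm, G.adj_comm b a]

lemma IsIndFree.adj_of_bull (h : IsIndFree G bull) {a b c x y : V} (hab : G.Adj a b)
    (hac : G.Adj a c) (hbc : G.Adj b c) (hax : G.Adj a x) (hby : G.Adj b y) (hbx : ¬ G.Adj b x)
    (hcx : ¬ G.Adj c x) (hay : ¬ G.Adj a y) (hcy : ¬ G.Adj c y) : G.Adj x y := by
  by_contra hxy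
  have hxy' : x ≠ y := by rintro rfl; exact hay hax
  have hcx' : c ≠ x := by rintro rfl; exact hbx hbc
  have hcy' : c ≠ y := by rintro rfl; exact hay hac
  have hbx' : b ≠ x := by rintro rfl; exact hcx hbc.symm
  have hay' : a ≠ y := by rintro rfl; exact hcy hac.symm
  refine h.not_adj_iff (f := ![c, a, b, x, y]) ?_ ?_
  · intro i j
    fin_cases i <;> fin_cases j <;>
      simp [hab.ne, hab.ne', hac.ne, hac.ne', hbc.ne, hbc.ne', hax.ne, hax.ne', hby.ne, hby.ne',
        hxy', hxy'.symm, hcx', hcx'.symm, hcy', hcy'.symm, hbx', hbx'.symm, hay', hay'.symm]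
  · intro i j
    fin_cases i <;> fin_cases j <;>
      simp [bull, hab, hac, hbc, hax, hby, hab.symm, hac.symm, hbc.symm, hax.symm, hby.symm, hbx,
        hcx, hay, hcy, hxy, G.adj_comm x b, G.adj_comm x c, G.adj_comm y a, G.adj_comm y c,
        G.adj_comm y x]

variable [DecidableEq V] [DecidableRel G.Adj]

/-- In a bull-free and diamond-free graph, a vertex-critical induced subgraph that needs more colors
than the size of its cliques is triangle-free. -/
lemma triangleFreeOn_of_minimal (hGb : IsIndFree G bull) (hGd : IsIndFree G diamond)
    {T : Finset V} {k : ℕ} (hclique : ∀ K : Finset V, G.IsClique K → K.card ≤ k)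
    (hT : ¬ ColorOn G T k) (hmin : ∀ U ⊂ T, ColorOn G U k) : TriangleFreeOn G T := by
  intro u hu v hv w hw huv hvw huw
  obtain ⟨K, hK, hKmax⟩ := Finset.exists_max_image
    (T.powerset.filter fun K : Finset V => G.IsClique (K : Set V) ∧ {u, v, w} ⊆ K) Finset.card
    ⟨{u, v, w}, by
      rw [Finset.mem_filter, Finset.mem_powerset]
      refine ⟨?_, ?_, subset_rfl⟩
      · simp [Finset.insert_subset_iff, hu, hv, hw]
      · push_cast
        rw [SimpleGraph.isClique_iff]
        intro a ha b hb hab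
        simp only [Set.mem_insert_iff, Set.mem_singleton_iff] at ha hb
        rcases ha with rfl | rfl | rfl <;> rcases hb with rfl | rfl | rfl <;>
          first | exact absurd rfl hab | assumption | (apply SimpleGraph.Adj.symm; assumption)⟩
  rw [Finset.mem_filter, Finset.mem_powerset] at hK
  obtain ⟨hKT, hKc, hKuvw⟩ := hK
  have hadj : ∀ a ∈ K, ∀ b ∈ K, a ≠ b → G.Adj a b := fun a ha b hb hab => hKc ha hb hab
  have hK3 : 3 ≤ K.card := by
    refine le_trans ?_ (Finset.card_le_card hKuvw)
    rw [Finset.card_eq_three.2 ⟨u, v, w, huv.ne, huw.ne, hvw.ne, rfl⟩]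
  have hmaximal : ∀ x ∈ T \ K, ∃ y ∈ K, ¬ G.Adj x y := by
    intro x hx
    rw [Finset.mem_sdiff] at hx
    by_contra! hall
    have := hKmax (insert x K) (by
      rw [Finset.mem_filter, Finset.mem_powerset]
      refine ⟨Finset.insert_subset hx.1 hKT, ?_, hKuvw.trans (Finset.subset_insert _ _)⟩
      rw [Finset.coe_insert, SimpleGraph.isClique_insert]
      exact ⟨hKc, fun b hb _ => hall b hb⟩)
    rw [Finset.card_insert_of_notMem hx.2] at this
    omega
  have hone : ∀ x ∈ T \ K, ∀ a ∈ K, ∀ b ∈ K, a ≠ b → G.Adj a x → ¬ G.Adj b x := by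
    intro x hx a ha b hb hab hax hbx
    obtain ⟨y, hy, hxy⟩ := hmaximal x hx
    have hya : y ≠ a := by rintro rfl; exact hxy hax.symm
    have hyb : y ≠ b := by rintro rfl; exact hxy hbx.symm
    have hxK := (Finset.mem_sdiff.1 hx).2
    have hxy' : x ≠ y := by rintro rfl; exact hxK hy
    exact hxy (hGd.adj_of_diamond hxy' (hadj a ha b hb hab) hax.symm hbx.symm (hadj y hy a ha hya)
      (hadj y hy b hb hyb))
  have hout : ∀ a ∈ K, ∃ x ∈ T \ K, G.Adj a x := by
    intro a ha
    by_contra! hall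
    have h1 := le_card_nbrsIn_of_minimal hT hmin (hKT ha)
    have h2 : nbrsIn G T a ⊆ K.erase a := by
      intro x hx
      rw [mem_nbrsIn] at hx
      refine Finset.mem_erase.2 ⟨hx.2.ne', ?_⟩
      by_contra hxK
      exact hall x (Finset.mem_sdiff.2 ⟨hx.1, hxK⟩) hx.2
    have h3 := Finset.card_le_card h2
    rw [Finset.card_erase_of_mem ha] at h3
    have h4 := hclique K hKc
    omega
  have hcross : ∀ a ∈ K, ∀ b ∈ K, a ≠ b → ∀ x ∈ T \ K, ∀ y ∈ T \ K, G.Adj a x → G.Adj b y →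
      G.Adj x y := by
    intro a ha b hb hab x hx y hy hax hby
    obtain ⟨c, hc, hca, hcb⟩ : ∃ c ∈ K, c ≠ a ∧ c ≠ b := by
      obtain ⟨c, hc, hc'⟩ := Finset.exists_mem_notMem_of_card_lt_card
        (show ({a, b} : Finset V).card < K.card from Finset.card_le_two.trans_lt hK3)
      exact ⟨c, hc, by simpa [not_or] using hc'⟩
    exact hGb.adj_of_bull (hadj a ha b hb hab) (hadj a ha c hc hca.symm) (hadj b hb c hc hcb.symm)
      hax hby (hone x hx a ha b hb hab hax) (hone x hx a ha c hc hca.symm hax)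
      (hone y hy b hb a ha hab.symm hby) (hone y hy b hb c hc hcb.symm hby)
  choose! p hp hpadj using hout
  have huniq : ∀ a ∈ K, ∀ x ∈ T \ K, G.Adj a x → x = p a := by
    intro a ha x hx hax
    by_contra hne
    obtain ⟨b, hb, hba⟩ := Finset.exists_mem_ne (by omega : 1 < K.card) a
    obtain ⟨c, hc, hca, hcb⟩ : ∃ c ∈ K, c ≠ a ∧ c ≠ b := by
      obtain ⟨c, hc, hc'⟩ := Finset.exists_mem_notMem_of_card_lt_card
        (show ({a, b} : Finset V).card < K.card from Finset.card_le_two.trans_lt hK3)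
      exact ⟨c, hc, by simpa [not_or] using hc'⟩
    have hxb := hcross a ha b hb hba.symm x hx _ (hp b hb) hax (hpadj b hb)
    have hxc := hcross a ha c hc hca.symm x hx _ (hp c hc) hax (hpadj c hc)
    have hpb := hcross a ha b hb hba.symm _ (hp a ha) _ (hp b hb) (hpadj a ha) (hpadj b hb)
    have hpc := hcross a ha c hc hca.symm _ (hp a ha) _ (hp c hc) (hpadj a ha) (hpadj c hc)
    have hbc := hcross b hb c hc hcb.symm _ (hp b hb) _ (hp c hc) (hpadj b hb) (hpadj c hc)
    have hxp : G.Adj x (p a) := hGd.adj_of_diamond hne hbc hxb hxc hpb hpc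
    have hne' : a ≠ p b := by
      intro h
      exact (Finset.mem_sdiff.1 (hp b hb)).2 (h ▸ ha)
    exact hone _ (hp b hb) b hb a ha hba (hpadj b hb)
      (hGd.adj_of_diamond hne' hxp hax (hpadj a ha) hxb.symm hpb.symm)
  obtain ⟨c, hc, hc'⟩ := hmin (T \ K) (Finset.sdiff_ssubset hKT ⟨u, hKuvw (by simp)⟩)
  obtain ⟨σ, hσ, -⟩ := K.countable_toSet.exists_cycleOn
  have hσK : ∀ a ∈ K, σ a ∈ K := fun a ha => hσ.1.mapsTo ha
  have hσne : ∀ a ∈ K, σ a ≠ a := fun a ha =>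
    hσ.apply_ne (Finset.one_lt_card_iff_nontrivial.1 (by omega)) ha
  have hpne : ∀ a ∈ K, ∀ b ∈ K, a ≠ b → c (p a) ≠ c (p b) := fun a ha b hb hab =>
    hc' _ (hp a ha) _ (hp b hb)
      (hcross a ha b hb hab _ (hp a ha) _ (hp b hb) (hpadj a ha) (hpadj b hb))
  have hmix : ∀ a ∈ K, ∀ x ∈ T, x ∉ K → G.Adj a x → c (p (σ a)) ≠ c x := by
    intro a ha x hx hxK hax
    rw [huniq a ha x (Finset.mem_sdiff.2 ⟨hx, hxK⟩) hax]
    exact hpne _ (hσK a ha) _ ha (hσne a ha)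
  refine hT ⟨fun a => if a ∈ K then c (p (σ a)) else c a, fun a ha => ?_, fun a ha b hb hab => ?_⟩
  · by_cases haK : a ∈ K
    · simpa [haK] using hc _ (hp _ (hσK a haK))
    · simpa [haK] using hc a (Finset.mem_sdiff.2 ⟨ha, haK⟩)
  · by_cases haK : a ∈ K <;> by_cases hbK : b ∈ K
    · simpa [haK, hbK] using
        hpne _ (hσK a haK) _ (hσK b hbK) fun h => hab.ne (σ.injective h)
    · simpa [haK, hbK] using hmix a haK b hb hbK hab
    · simpa [haK, hbK] using (hmix b hbK a ha haK hab.symm).symm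
    · simpa [haK, hbK] using
        hc' a (Finset.mem_sdiff.2 ⟨ha, haK⟩) b (Finset.mem_sdiff.2 ⟨hb, hbK⟩) hab

end BullDiamond

theorem statement_2 {V : Type*} [Fintype V] (G : SimpleGraph V)
    (hGb : IsIndFree G bull) (hGd : IsIndFree G diamond)
    (hn : 2 ≤ Fintype.card V) (hm : 2 ≤ G.edgeSet.ncard) :
    G.chromaticNumber ≤ (G.cliqueNum : ℕ∞) ∨
      (G.chromaticNumber.toNat : ℝ) ≤
        min (4 * Real.sqrt (Fintype.card V))
          (min (8 * Real.sqrt ((Fintype.card V : ℝ) / Real.log (Fintype.card V)))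
            (28 * (G.edgeSet.ncard : ℝ) ^ ((1 : ℝ)/3) /
              (Real.log (G.edgeSet.ncard)) ^ ((2 : ℝ)/3))) := by
  classical
  rw [or_iff_not_imp_left]
  intro hχ
  have hcast : (G.chromaticNumber.toNat : ℕ∞) = G.chromaticNumber :=
    ENat.natCast_toNat (SimpleGraph.chromaticNumber_ne_top_iff_exists.2 ⟨_, G.colorable_of_fintype⟩)
  rw [← hcast, Nat.cast_le, not_le] at hχ
  obtain ⟨k, hk⟩ := Nat.exists_eq_add_of_lt (Nat.zero_lt_of_lt hχ)
  rw [zero_add] at hk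
  rw [hk] at hχ hcast ⊢
  have hnot : ¬ ColorOn G Finset.univ k := by
    rintro ⟨c, hc, hc'⟩
    have hcol : G.Colorable k := ⟨SimpleGraph.Coloring.mk
      (fun v => (⟨c v, hc v (Finset.mem_univ v)⟩ : Fin k)) fun {a b} hab h =>
        hc' a (Finset.mem_univ a) b (Finset.mem_univ b) hab (congrArg Fin.val h)⟩
    have := hcol.chromaticNumber_le
    rw [← hcast, Nat.cast_le] at this
    omega
  obtain ⟨T, -, hT, hmin⟩ := exists_minimal_not_colorOn hnot
  have hT3 : TriangleFreeOn G T := triangleFreeOn_of_minimal hGb hGd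
    (fun K hK => hK.card_le_cliqueNum.trans (by omega)) hT hmin
  set n : ℝ := (Fintype.card V : ℝ) with hndef
  have hn2 : 2 ≤ n := by rw [hndef]; exact_mod_cast hn
  have hTn : (T.card : ℝ) ≤ n := by rw [hndef]; exact_mod_cast Finset.card_le_univ T
  have hsqrt : ((k : ℝ) + 1) ^ 2 ≤ 4 * n := by
    have hcard : (k : ℝ) * (k + 1) + 2 ≤ 2 * T.card := by exact_mod_cast hT3.two_mul_card_ge hT
    nlinarith [sq_nonneg ((k : ℝ) - 1)]
  have hlogn : 0 < Real.log n := Real.log_pos (by linarith)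
  push_cast
  refine le_min ?_ (le_min ?_ ?_)
  · have : ((k : ℝ) + 1) / 2 ≤ √n := Real.le_sqrt_of_sq_le (by nlinarith)
    have := Real.sqrt_nonneg n
    linarith
  · rcases le_total 16 (Real.log n) with h16 | h16
    · exact hT3.succ_le_sqrt_div_log h16 (by linarith) hTn hT
    · have : ((k : ℝ) + 1) / 8 ≤ √(n / Real.log n) := by
        apply Real.le_sqrt_of_sq_le
        rw [le_div_iff₀ hlogn]
        have : ((k : ℝ) + 1) ^ 2 * Real.log n ≤ 4 * n * 16 := by gcongr
        linarith
      linarith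
  · set m : ℝ := (G.edgeSet.ncard : ℝ) with hmdef
    have hm2 : 2 ≤ m := by rw [hmdef]; exact_mod_cast hm
    have hlogm : 0 < Real.log m := Real.log_pos (by linarith)
    have hdeg : ∑ v ∈ T, ((nbrsIn G T v).card : ℝ) ≤ 2 * m := by
      have h1 : ∑ v ∈ T, (nbrsIn G T v).card ≤ 2 * G.edgeSet.ncard := by
        rw [← SimpleGraph.coe_edgeFinset, Set.ncard_coe_finset, ← G.sum_degrees_eq_twice_card_edges]
        refine le_trans (Finset.sum_le_sum fun v _ => ?_)
          (Finset.sum_le_sum_of_subset (Finset.subset_univ T))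
        refine Finset.card_le_card fun x hx => ?_
        simpa using (mem_nbrsIn.1 hx).2
      rw [hmdef]
      exact_mod_cast h1
    rw [mul_div_assoc]
    refine hT3.succ_le_edge_bound hdeg (by linarith) (by positivity) ?_ hT
    rw [div_pow, ← Real.rpow_natCast, ← Real.rpow_natCast (_ ^ _), ← Real.rpow_mul (by linarith),
      ← Real.rpow_mul hlogm.le]
    norm_num
    field_simp
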